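/- Let μ be the Bernoulli measure on {a,b}^ℕ with μ(a) = p and μ(b) = 1−p, 0 < p < 1, and let f be the run-length encoder. For every even n ∈ ℕ, Σ_{C_n} (f_*μ)(C_n)² = (p² + (1−p)²)·(p²/(1−p²))^{n/2}·((1−p)²/(1−(1−p)²))^{n/2}, where the sum is over all cylinders C_n of length n in B^ℕ. -/

import Mathlib

open MeasureTheory Filter Topology

section RLEDefs

variable {A : Type*}

/-- The starting position of the run following the run that starts at position `i`:
the least index `> i` where the value of `x` changes (with the junk convention `i + 1`
if the sequence is constant from position `i` on). -/
noncomputable def nextChange (x : ℕ → A) (i : ℕ) : ℕ := by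
  classical
  exact if h : ∃ j, x (i + j + 1) ≠ x i then i + Nat.find h + 1 else i + 1

/-- Starting position of the `n`-th maximal run of the sequence `x`. -/
noncomputable def runStart (x : ℕ → A) : ℕ → ℕ
  | 0 => 0
  | n + 1 => nextChange x (runStart x n)

/-- The run-length encoder `f : A^ℕ → (A × ℕ)^ℕ`: the `n`-th symbol of `f x` is the pair
(value of the `n`-th maximal run of `x`, length of that run). -/
noncomputable def rle (x : ℕ → A) (n : ℕ) : A × ℕ :=
  (x (runStart x n), runStart x (n + 1) - runStart x n)

/-- `M_n(u,v)`: the length of the longest common substring of `u` and `v`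
occurring within their first `n` symbols, i.e.
`max {k : u_i^{i+k-1} = v_j^{j+k-1} for some 0 ≤ i,j ≤ n-k}`. -/
noncomputable def matchLen {C : Type*} (u v : ℕ → C) (n : ℕ) : ℕ :=
  sSup {k | ∃ i j, i + k ≤ n ∧ j + k ≤ n ∧ ∀ m < k, u (i + m) = v (j + m)}

/-- `M^RLE_n(x,y) = M_n(f x, f y)`. -/
noncomputable def MRLE (x y : ℕ → A) (n : ℕ) : ℕ := matchLen (rle x) (rle y) n

/-- `M̃_n(x,y) = max {k : f(σ^i x)_1^k = f(σ^j y)_1^k for some 0 ≤ i,j ≤ n-k}`. -/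
noncomputable def Mtilde (x y : ℕ → A) (n : ℕ) : ℕ :=
  sSup {k | ∃ i j, i + k ≤ n ∧ j + k ≤ n ∧
    ∀ m < k, rle (fun t => x (t + i)) m = rle (fun t => y (t + j)) m}

/-- The number of maximal runs in the first `n` symbols of `x`, i.e. `|f(x_1^n)|`. -/
noncomputable def runCount (x : ℕ → A) (n : ℕ) : ℕ := by
  classical
  exact ((Finset.range n).filter fun i => i = 0 ∨ x i ≠ x (i - 1)).card

/-- The left shift `σ` on sequences. -/
def shift (x : ℕ → A) : ℕ → A := fun n => x (n + 1)

variable [MeasurableSpace A]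

/-- `Σ_{ω ∈ B^n} (f_*μ)(ω)²`: the sum, over all cylinders `ω` of length `n` in
`B^ℕ = (A × ℕ)^ℕ`, of the squared measure of `f⁻¹ω` (where `f` is the run-length
encoder), i.e. of the squared pushforward measure of the cylinder. -/
noncomputable def pushCylSum (μ : Measure (ℕ → A)) (n : ℕ) : ℝ :=
  ∑' ω : Fin n → A × ℕ, ((μ {x | ∀ i : Fin n, rle x i = ω i}).toReal) ^ 2

/-- Lower Rényi entropy of order 2 of the pushforward measure `f_*μ`:
`H̲₂(f_*μ) = - liminf_n (1/n) log Σ_ω (f_*μ)(ω)²`. -/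
noncomputable def H2lower (μ : Measure (ℕ → A)) : ℝ :=
  -liminf (fun n : ℕ => Real.log (pushCylSum μ n) / n) atTop

/-- Upper Rényi entropy of order 2 of the pushforward measure `f_*μ`:
`H̄₂(f_*μ) = - limsup_n (1/n) log Σ_ω (f_*μ)(ω)²`. -/
noncomputable def H2upper (μ : Measure (ℕ → A)) : ℝ :=
  -limsup (fun n : ℕ => Real.log (pushCylSum μ n) / n) atTop

/-- Hypothesis (A): there are `c > 0`, `h > 0` with `μ(a…a) ≤ c e^{-hn}` for every
constant cylinder `a…a` of length `n`. -/
def HypA (μ : Measure (ℕ → A)) (c h : ℝ) : Prop :=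
  0 < c ∧ 0 < h ∧
    ∀ (n : ℕ) (a : A), μ {x | ∀ i < n, x i = a} ≤ ENNReal.ofReal (c * Real.exp (-h * n))

/-- The σ-algebra `F_0^n` generated by the coordinates `X_0, …, X_n`. -/
def cylAlgLE (A : Type*) [MeasurableSpace A] (n : ℕ) : MeasurableSpace (ℕ → A) :=
  MeasurableSpace.comap (fun x (i : Fin (n + 1)) => x i) inferInstance

/-- The σ-algebra `F_m^∞` generated by the coordinates `X_m, X_{m+1}, …`. -/
def cylAlgGE (A : Type*) [MeasurableSpace A] (m : ℕ) : MeasurableSpace (ℕ → A) :=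
  MeasurableSpace.comap (fun x (i : ℕ) => x (m + i)) inferInstance

/-- α-mixing with rate function `a`: for all `n, g` and all `S ∈ F_0^n`, `T ∈ F_{n+g}^∞`,
`|μ(S ∩ T) - μ(S)μ(T)| ≤ a(g)`. -/
def AlphaMixingBound (μ : Measure (ℕ → A)) (a : ℕ → ℝ) : Prop :=
  ∀ (n g : ℕ) (S T : Set (ℕ → A)),
    MeasurableSet[cylAlgLE A n] S → MeasurableSet[cylAlgGE A (n + g)] T →
    |(μ (S ∩ T)).toReal - (μ S).toReal * (μ T).toReal| ≤ a g

/-- α-mixing with exponential decay. -/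
def AlphaMixingExp (μ : Measure (ℕ → A)) : Prop :=
  ∃ C θ : ℝ, 0 < C ∧ 0 < θ ∧ AlphaMixingBound μ fun g => C * Real.exp (-θ * g)

/-- ψ-mixing with polynomial rate `ψ(g) = g^{-a}`: for all `n` and `g ≥ 1` and all
`S ∈ F_0^n`, `T ∈ F_{n+g}^∞`, `|μ(S ∩ T) - μ(S)μ(T)| ≤ g^{-a} μ(S) μ(T)`. -/
def PsiMixingPoly (μ : Measure (ℕ → A)) (a : ℝ) : Prop :=
  ∀ (n g : ℕ), 1 ≤ g → ∀ (S T : Set (ℕ → A)),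
    MeasurableSet[cylAlgLE A n] S → MeasurableSet[cylAlgGE A (n + g)] T →
    |(μ (S ∩ T)).toReal - (μ S).toReal * (μ T).toReal| ≤
      (g : ℝ) ^ (-a) * (μ S).toReal * (μ T).toReal

/-- `S_n = Σ_{0 ≤ i,j ≤ n-1} 1_{A_{i,j}}` with `A_{i,j} = {f(σ^i X)_1^k = f(σ^j Y)_1^k}`,
seen as a random variable on the product space (X = first coordinate, Y = second). -/
noncomputable def Sn (k n : ℕ) (p : (ℕ → A) × (ℕ → A)) : ℝ := by
  classical
  exact ∑ i ∈ Finset.range n, ∑ j ∈ Finset.range n,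
    if ∀ m < k, rle (fun t => p.1 (t + i)) m = rle (fun t => p.2 (t + j)) m then (1 : ℝ) else 0

end RLEDefs

def rlePre : List Bool → (ℕ → Bool) → Prop
  | [], _ => True
  | a :: l, x => x 0 = a ∧ rlePre l (fun t => x (t + 1))

def rleWord : (n : ℕ) → Bool → (Fin n → ℕ) → List Bool
  | 0, c, _ => [c]
  | n + 1, c, ks => List.replicate (ks 0 + 1) c ++ rleWord n (!c) (Fin.tail ks)

def rlePhi : (n : ℕ) → Bool → (Fin n → ℕ) → (Fin n → Bool × ℕ)
  | 0, _, _ => Fin.elim0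
  | n + 1, c, ks => Fin.cons (c, ks 0 + 1) (rlePhi n (!c) (Fin.tail ks))

def rleNEC (x : ℕ → Bool) : Prop := ∀ i, ∃ j, x (i + j + 1) ≠ x i

def rleW (p : ℝ) (c : Bool) : ℝ := if c then p else 1 - p

theorem rlePre_iff (l : List Bool) (x : ℕ → Bool) :
    rlePre l x ↔ ∀ i : Fin l.length, x i = l.get i := by
  induction l generalizing x with
  | nil => simp [rlePre]
  | cons a l ih =>
    rw [rlePre, ih]
    constructor
    · rintro ⟨h0, h⟩ i
      refine Fin.cases ?_ (fun j => ?_) i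
      · simpa using h0
      · simpa using h j
    · intro h
      exact ⟨by simpa using h ⟨0, by simp⟩, fun i => by simpa using h i.succ⟩

theorem rlePre_replicate (k : ℕ) (c : Bool) (l : List Bool) (x : ℕ → Bool) :
    rlePre (List.replicate k c ++ l) x ↔ (∀ j < k, x j = c) ∧ rlePre l (fun t => x (t + k)) := by
  induction k generalizing x with
  | zero => simp
  | succ k ih =>
    rw [List.replicate_succ, List.cons_append, rlePre, ih, ← and_assoc]
    have : (x 0 = c ∧ ∀ j < k, x (j + 1) = c) ↔ ∀ j < k + 1, x j = c := by
      constructor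
      · rintro ⟨h0, h⟩ j hj
        cases j with
        | zero => exact h0
        | succ j => exact h j (by omega)
      · intro h
        exact ⟨h 0 (by omega), fun j hj => h _ (by omega)⟩
    rw [this]
    simp [add_assoc, add_comm 1 k]

theorem rleNextChange_of (x : ℕ → Bool) (i j : ℕ) (h : x (i + j + 1) ≠ x i)
    (h' : ∀ m < j, x (i + m + 1) = x i) : nextChange x i = i + j + 1 := by
  classical
  have hx : ∃ j, x (i + j + 1) ≠ x i := ⟨j, h⟩
  unfold nextChange
  rw [dif_pos hx]
  have := (Nat.find_eq_iff (m := j) hx).2 ⟨h, fun m hm => not_not.2 (h' m hm)⟩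
  rw [← this]
  congr!

theorem rleNextChange_first (x : ℕ → Bool) (i : ℕ) (hx : ∃ j, x (i + j + 1) ≠ x i) :
    ∃ j, x (i + j + 1) ≠ x i ∧ ∀ m < j, x (i + m + 1) = x i := by
  classical
  exact ⟨Nat.find hx, Nat.find_spec hx, fun m hm => not_not.1 (Nat.find_min hx hm)⟩

theorem rleNextChange_shift (x : ℕ → Bool) (k i : ℕ) :
    nextChange x (i + k) = nextChange (fun t => x (t + k)) i + k := by
  have e : ∀ j, i + k + j + 1 = i + j + 1 + k := fun j => by omega
  by_cases hx : ∃ j, x (i + k + j + 1) ≠ x (i + k)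
  · obtain ⟨j, h1, h2⟩ := rleNextChange_first x (i + k) hx
    rw [rleNextChange_of x (i + k) j h1 h2]
    simp only [e] at h1 h2
    rw [rleNextChange_of (fun t => x (t + k)) i j h1 h2, e]
  · have hx' : ¬ ∃ j, x (i + j + 1 + k) ≠ x (i + k) := by simpa only [e] using hx
    unfold nextChange
    rw [dif_neg hx, dif_neg hx']
    omega

theorem rleRunStart_succ (x : ℕ → Bool) (m : ℕ) :
    runStart x (m + 1) = runStart (fun t => x (t + nextChange x 0)) m + nextChange x 0 := by
  induction m with
  | zero => simp [runStart]
  | succ m ih =>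
    rw [runStart, ih, rleNextChange_shift]
    rfl

theorem rle_succ' (x : ℕ → Bool) (m : ℕ) :
    rle x (m + 1) = rle (fun t => x (t + nextChange x 0)) m := by
  unfold rle
  rw [rleRunStart_succ x (m + 1), rleRunStart_succ x m, Nat.add_sub_add_right]

theorem rle_zero' (x : ℕ → Bool) : rle x 0 = (x 0, nextChange x 0) := by
  simp [rle, runStart]

theorem rleNextChange_eq (x : ℕ → Bool) (hx : rleNEC x) (k : ℕ) :
    nextChange x 0 = k + 1 ↔ (∀ j < k + 1, x j = x 0) ∧ x (k + 1) = !(x 0) := by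
  have h3 : ∀ a b : Bool, a = !b ↔ a ≠ b := by decide
  rw [h3]
  constructor
  · obtain ⟨j, h1, h2⟩ := rleNextChange_first x 0 (hx 0)
    rw [rleNextChange_of x 0 j h1 h2]
    intro h
    obtain rfl : j = k := by omega
    simp only [zero_add] at h1 h2
    refine ⟨fun m hm => ?_, h1⟩
    cases m with
    | zero => rfl
    | succ m => exact h2 m (by omega)
  · rintro ⟨h1, h2⟩
    rw [rleNextChange_of x 0 k (by simpa using h2)
      (fun m hm => by simpa using h1 (m + 1) (by omega)), zero_add]

theorem rleNextChange_pos (x : ℕ → Bool) (hx : rleNEC x) : ∃ k, nextChange x 0 = k + 1 := by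
  classical
  unfold nextChange
  rw [dif_pos (hx 0)]
  exact ⟨_, by rw [zero_add]⟩

theorem rleNEC_shift (x : ℕ → Bool) (hx : rleNEC x) (k : ℕ) : rleNEC (fun t => x (t + k)) := by
  intro i
  obtain ⟨j, hj⟩ := hx (i + k)
  refine ⟨j, ?_⟩
  rw [show i + k + j + 1 = i + j + 1 + k by omega] at hj
  exact hj

theorem rle_main (n : ℕ) (c : Bool) (ks : Fin n → ℕ) (x : ℕ → Bool) (hx : rleNEC x) :
    (x 0 = c ∧ ∀ i : Fin n, rle x i = rlePhi n c ks i) ↔ rlePre (rleWord n c ks) x := by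
  induction n generalizing c x with
  | zero => simp [rleWord, rlePre]
  | succ n ih =>
    rw [rleWord, rlePre_replicate, ← ih _ _ _ (rleNEC_shift x hx _), Fin.forall_fin_succ]
    have hn := rleNextChange_eq x hx (ks 0)
    simp only [rlePhi, Fin.cons_zero, Fin.cons_succ, Fin.val_zero, Fin.val_succ, rle_zero',
      rle_succ', Prod.mk.injEq, zero_add]
    constructor
    · rintro ⟨h0, ⟨-, h1⟩, h2⟩
      rw [h1] at h2
      obtain ⟨h3, h4⟩ := hn.1 h1
      subst h0
      exact ⟨h3, h4, h2⟩
    · rintro ⟨h1, h2, h3⟩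
      have h0 : x 0 = c := h1 0 (by omega)
      subst h0
      have h4 := hn.2 ⟨h1, h2⟩
      rw [h4]
      exact ⟨rfl, ⟨rfl, rfl⟩, h3⟩

theorem rle_range (n : ℕ) (x : ℕ → Bool) (hx : rleNEC x) :
    ∃ ks, (fun i : Fin n => rle x i) = rlePhi n (x 0) ks := by
  induction n generalizing x with
  | zero => exact ⟨Fin.elim0, by funext i; exact i.elim0⟩
  | succ n ih =>
    obtain ⟨k, hk⟩ := rleNextChange_pos x hx
    obtain ⟨ks, h⟩ := ih _ (rleNEC_shift x hx (k + 1))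
    refine ⟨Fin.cons k ks, ?_⟩
    have h1 := ((rleNextChange_eq x hx k).1 hk).2
    funext i
    refine Fin.cases ?_ (fun j => ?_) i
    · simp [rlePhi, rle_zero', hk]
    · have := congrFun h j
      simp only [zero_add, h1] at this
      simp only [rlePhi, Fin.cons_succ, Fin.val_succ, rle_succ', hk, Fin.tail_cons]
      exact this

theorem rlePhi_inj (n : ℕ) (c : Bool) (ks ks' : Fin n → ℕ)
    (h : rlePhi n c ks = rlePhi n c ks') : ks = ks' := by
  induction n generalizing c with
  | zero => exact Subsingleton.elim _ _
  | succ n ih =>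
    rw [rlePhi, rlePhi] at h
    obtain ⟨h1, h2⟩ := Fin.cons_injective2 h
    have h3 := ih _ _ _ h2
    rw [← Fin.cons_self_tail ks, ← Fin.cons_self_tail ks', h3]
    simp at h1
    rw [h1]

theorem rlePre_measure (p : ℝ) (μ : Measure (ℕ → Bool))
    (hμ : ∀ (n : ℕ) (w : Fin n → Bool),
      μ {x | ∀ i : Fin n, x i = w i} =
        ENNReal.ofReal (∏ i : Fin n, if w i then p else 1 - p)) (l : List Bool) :
    μ {x | rlePre l x} = ENNReal.ofReal ((l.map (rleW p)).prod) := by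
  simp only [rlePre_iff, hμ]
  congr 1
  have := Fin.prod_univ_fun_getElem l (rleW p)
  rw [← this]
  rfl

theorem rleW_pos (p : ℝ) (hp0 : 0 < p) (hp1 : p < 1) (c : Bool) : 0 < rleW p c ∧ rleW p c < 1 := by
  cases c <;> simp [rleW] <;> constructor <;> linarith

theorem rlePre_append_of (x : ℕ → Bool) (c : Bool) (N : ℕ) (h : ∀ j, x (N + j) = c) (m : ℕ) :
    rlePre (List.ofFn (fun i : Fin N => x i) ++ List.replicate m c) x := by
  rw [rlePre_iff]
  intro i
  simp only [List.get_eq_getElem, List.getElem_append, List.length_ofFn, List.getElem_ofFn,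
    List.getElem_replicate]
  split_ifs with hi
  · rfl
  · have := h (i - N)
    rwa [Nat.add_sub_cancel' (by omega)] at this

theorem rleNEC_ae (p : ℝ) (hp0 : 0 < p) (hp1 : p < 1) (μ : Measure (ℕ → Bool))
    (hμ : ∀ (n : ℕ) (w : Fin n → Bool),
      μ {x | ∀ i : Fin n, x i = w i} =
        ENNReal.ofReal (∏ i : Fin n, if w i then p else 1 - p)) :
    ∀ᵐ x ∂μ, rleNEC x := by
  have key : ∀ (l : List Bool) (c : Bool), ∀ᵐ x ∂μ, ¬ ∀ m, rlePre (l ++ List.replicate m c) x := by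
    intro l c
    rw [ae_iff]
    simp only [not_not]
    refine le_antisymm ?_ bot_le
    have hb : ∀ m, μ {x | ∀ m, rlePre (l ++ List.replicate m c) x} ≤
        ENNReal.ofReal ((l.map (rleW p)).prod * rleW p c ^ m) := by
      intro m
      have hsub : {x | ∀ m, rlePre (l ++ List.replicate m c) x} ⊆
          {x | rlePre (l ++ List.replicate m c) x} := fun x hx => hx m
      refine (measure_mono hsub).trans ?_
      rw [rlePre_measure p μ hμ]
      simp
    have hw := rleW_pos p hp0 hp1 c
    have ht : Tendsto (fun m => ENNReal.ofReal ((l.map (rleW p)).prod * rleW p c ^ m)) atTop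
        (𝓝 (ENNReal.ofReal ((l.map (rleW p)).prod * 0))) :=
      ENNReal.tendsto_ofReal
        ((tendsto_pow_atTop_nhds_zero_of_lt_one hw.1.le hw.2).const_mul _)
    rw [mul_zero, ENNReal.ofReal_zero] at ht
    exact ge_of_tendsto' ht hb
  have key2 := ae_all_iff.2 fun l => ae_all_iff.2 fun c => key l c
  filter_upwards [key2] with x hx i
  by_contra! hcon
  refine hx _ (x i) (rlePre_append_of x (x i) i ?_)
  intro j
  cases j with
  | zero => rfl
  | succ j => exact hcon j

theorem rle_hasSum (p : ℝ) (hp0 : 0 < p) (hp1 : p < 1) (n : ℕ) : ∃ S : Bool → ℝ,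
    (∀ c, HasSum (fun ks : Fin n → ℕ => (((rleWord n c ks).map (rleW p)).prod) ^ 2) (S c)) ∧
    (Even n → ∀ c, S c = rleW p c ^ 2 * ((p ^ 2 / (1 - p ^ 2)) ^ (n / 2) *
        ((1 - p) ^ 2 / (1 - (1 - p) ^ 2)) ^ (n / 2))) ∧
    (¬ Even n → ∀ c, S c = (rleW p c ^ 2 / (1 - rleW p c ^ 2)) * rleW p (!c) ^ 2 *
      ((p ^ 2 / (1 - p ^ 2)) ^ (n / 2) *
        ((1 - p) ^ 2 / (1 - (1 - p) ^ 2)) ^ (n / 2))) := by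
  induction n with
  | zero =>
    refine ⟨fun c => rleW p c ^ 2, fun c => ?_, by simp, by simp⟩
    have := hasSum_fintype (fun ks : Fin 0 → ℕ => (((rleWord 0 c ks).map (rleW p)).prod) ^ 2)
    simpa [rleWord] using this
  | succ n ih =>
    obtain ⟨S, h1, h2, h3⟩ := ih
    refine ⟨fun c => (rleW p c ^ 2 / (1 - rleW p c ^ 2)) * S (!c), fun c => ?_, ?_, ?_⟩
    · have hw := rleW_pos p hp0 hp1 c
      have hg : HasSum (fun k : ℕ => (rleW p c ^ (k + 1)) ^ 2)
          (rleW p c ^ 2 / (1 - rleW p c ^ 2)) := by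
        have := (hasSum_geometric_of_lt_one (r := rleW p c ^ 2) (by positivity)
          (by nlinarith)).mul_left (rleW p c ^ 2)
        rw [← div_eq_mul_inv] at this
        have e : (fun k : ℕ => (rleW p c ^ (k + 1)) ^ 2) =
            fun k => rleW p c ^ 2 * (rleW p c ^ 2) ^ k := by
          funext k
          ring
        rw [e]
        exact this
      have hm := HasSum.mul hg (h1 (!c)) (hg.summable.mul_of_nonneg (h1 (!c)).summable
        (fun _ => sq_nonneg _) (fun _ => sq_nonneg _))
      rw [← (Fin.consEquiv (fun _ : Fin (n + 1) => ℕ)).hasSum_iff]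
      refine Eq.mp (congrArg (fun F => HasSum F _) ?_) hm
      funext y
      have ht : Fin.tail ((Fin.consEquiv (fun _ : Fin (n + 1) => ℕ)) y) = y.2 := rfl
      simp only [Function.comp, Fin.consEquiv_apply, rleWord, Fin.cons_zero, ht,
        List.map_append, List.prod_append, List.map_replicate, List.prod_replicate]
      ring
    · intro he c
      have ho : ¬ Even n := by rwa [Nat.even_add_one] at he
      have hd : (n + 1) / 2 = n / 2 + 1 := by
        rw [Nat.not_even_iff_odd] at ho; obtain ⟨k, rfl⟩ := ho; omega
      simp only [h3 ho, hd, pow_succ, Bool.not_not]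
      cases c <;> simp [rleW] <;> ring
    · intro he c
      have ho : Even n := by rwa [Nat.even_add_one, not_not] at he
      have hd : (n + 1) / 2 = n / 2 := by
        obtain ⟨k, rfl⟩ := ho; omega
      simp only [h2 ho, hd]
      ring

/-- Example `exbern`: for the Bernoulli measure on `{a,b}^ℕ`
(`a = true`, `b = false`, `μ(a) = p`, `μ(b) = 1-p`, `0 < p < 1`), for every even `n ≥ 1`,
`Σ_{C_n} (f_*μ)(C_n)² = (p² + (1-p)²) (p²/(1-p²))^{n/2} ((1-p)²/(1-(1-p)²))^{n/2}`. -/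
theorem stmt11 (p : ℝ) (hp0 : 0 < p) (hp1 : p < 1)
    (μ : Measure (ℕ → Bool)) [IsProbabilityMeasure μ]
    (hμ : ∀ (n : ℕ) (w : Fin n → Bool),
      μ {x | ∀ i : Fin n, x i = w i} =
        ENNReal.ofReal (∏ i : Fin n, if w i then p else 1 - p))
    (n : ℕ) (hn : Even n) (hn0 : 0 < n) :
    pushCylSum μ n =
      (p ^ 2 + (1 - p) ^ 2) * (p ^ 2 / (1 - p ^ 2)) ^ (n / 2) *
        ((1 - p) ^ 2 / (1 - (1 - p) ^ 2)) ^ (n / 2) := by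
  have hae := rleNEC_ae p hp0 hp1 μ hμ
  obtain ⟨S, h1, h2, -⟩ := rle_hasSum p hp0 hp1 n
  let Φ : Bool × (Fin n → ℕ) → (Fin n → Bool × ℕ) := fun q => rlePhi n q.1 q.2
  have hc0 : ∀ c ks, (rlePhi n c ks ⟨0, hn0⟩).1 = c := by
    intro c ks
    cases n with
    | zero => omega
    | succ n => rfl
  have hinj : Function.Injective Φ := by
    rintro ⟨c, ks⟩ ⟨c', ks'⟩ h
    have hc : c = c' := by
      rw [← hc0 c ks, ← hc0 c' ks']
      exact congrArg Prod.fst (congrFun h _)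
    subst hc
    rw [rlePhi_inj n c ks ks' h]
  have hval : ∀ q, (μ {x | ∀ i : Fin n, rle x i = Φ q i}).toReal =
      ((rleWord n q.1 q.2).map (rleW p)).prod := by
    rintro ⟨c, ks⟩
    have : μ {x | ∀ i : Fin n, rle x i = Φ (c, ks) i} = μ {x | rlePre (rleWord n c ks) x} := by
      apply measure_congr
      filter_upwards [hae] with x hx
      rw [eq_iff_iff]
      refine Iff.trans ?_ (rle_main n c ks x hx)
      refine ⟨fun h => ⟨?_, h⟩, fun h => h.2⟩
      have h0 := congrArg Prod.fst (h ⟨0, hn0⟩)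
      rw [hc0] at h0
      exact h0
    rw [this, rlePre_measure p μ hμ, ENNReal.toReal_ofReal]
    apply List.prod_nonneg
    intro a ha
    obtain ⟨b, -, rfl⟩ := List.mem_map.1 ha
    exact (rleW_pos p hp0 hp1 b).1.le
  have hoff : Function.support (fun ω : Fin n → Bool × ℕ =>
      ((μ {x | ∀ i : Fin n, rle x i = ω i}).toReal) ^ 2) ⊆ Set.range Φ := by
    intro ω hω
    by_contra hr
    apply hω
    have : μ {x | ∀ i : Fin n, rle x i = ω i} = 0 := by
      rw [← nonpos_iff_eq_zero, ← ae_iff.1 hae]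
      apply measure_mono
      intro x hx hN
      obtain ⟨ks, hks⟩ := rle_range n x hN
      exact hr ⟨(x 0, ks), by rw [← funext hx]; exact hks.symm⟩
    simp [this]
  unfold pushCylSum
  rw [← hinj.tsum_eq hoff]
  simp only [hval]
  have hs : Summable (fun q : Bool × (Fin n → ℕ) =>
      (((rleWord n q.1 q.2).map (rleW p)).prod) ^ 2) := by
    rw [summable_prod_of_nonneg (fun _ => sq_nonneg _)]
    exact ⟨fun c => (h1 c).summable, (hasSum_fintype _).summable⟩
  rw [hs.tsum_prod, tsum_fintype]
  simp only [fun c => (h1 c).tsum_eq, Fintype.sum_bool, h2 hn]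
  simp [rleW]
  ring
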